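/- Fix n ≥ 1 and p ∈ (0,1). For a set A ⊆ {1,…,n} of active sensors, let R(A) be the length of the longest run of consecutive indices not in A (so R({1,…,n}) = 0 and R(∅) = n), and let E[R_n] = Σ_{A ⊆ {1,…,n}} Pr(E_A) R(A). Then (E[R_n] + 1)/(2n) ≤ C(x^eq) ≤ (E[R_n] + 1)/(2n) + (2p/(1−p) + 1)/n. -/

import Mathlib

open Finset MeasureTheory

/-- Coverage cost on the line `[0,1]` for placement `x` and active set `A`:
the largest distance from a point of `[0,1]` to the closest active sensor
(`1` by convention if `A = ∅`). -/
noncomputable def cost0 {n : ℕ} (x : Fin n → ℝ) (A : Finset (Fin n)) : ℝ :=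
  if A.Nonempty then ⨆ s : Set.Icc (0:ℝ) 1, ⨅ j : A, |s.1 - x j.1| else 1

/-- Probability that `A` is the active set, under independent failures with
probability `p`. -/
noncomputable def prob {n : ℕ} (p : ℝ) (A : Finset (Fin n)) : ℝ :=
  p ^ (n - A.card) * (1 - p) ^ A.card

/-- Expected coverage cost `C(x)` under independent failures with probability `p`. -/
noncomputable def expCost {n : ℕ} (p : ℝ) (x : Fin n → ℝ) : ℝ :=
  ∑ A : Finset (Fin n), prob p A * cost0 x A

/-- The equispaced placement `x^eq`, whose `i`-th entry (`i = 0, …, n-1`) is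
`(2i+1)/(2n)`. -/
noncomputable def xeq (n : ℕ) : Fin n → ℝ := fun i => (2 * (i : ℝ) + 1) / (2 * n)

/-- The `k`-th smallest element of the finite set `A` (0-based). -/
noncomputable def nth {n : ℕ} (A : Finset (Fin n)) (k : Fin A.card) : Fin n :=
  (A.orderIsoOfFin rfl k).1

/-- Coverage cost on the circle of circumference 1 for the active set `A`. -/
noncomputable def ccost0 {n : ℕ} (x : Fin n → ℝ) (A : Finset (Fin n)) : ℝ :=
  if A.Nonempty then
    ⨆ s : Set.Icc (0:ℝ) 1, ⨅ j : A, min |s.1 - x j.1| (1 - |s.1 - x j.1|)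
  else 1

/-- Expected circle coverage cost `C̃(x)`. -/
noncomputable def cExpCost {n : ℕ} (p : ℝ) (x : Fin n → ℝ) : ℝ :=
  ∑ A : Finset (Fin n), prob p A * ccost0 x A

/-- Harmonic number `H_m = ∑_{h=1}^m 1/h`. -/
noncomputable def H (m : ℕ) : ℝ := ∑ i ∈ Finset.range m, 1 / ((i : ℝ) + 1)

/-- Length of the longest run of consecutive indices of `{0, …, n-1}` not
belonging to `A`. -/
noncomputable def longestRun {n : ℕ} (A : Finset (Fin n)) : ℕ :=
  sSup {r : ℕ | ∃ a : ℕ, a + r ≤ n ∧ ∀ i : Fin n, a ≤ i.1 → i.1 < a + r → i ∉ A}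

/-- Expected cost in the Cortés (constant-number-of-failures) model where
exactly `k` sensors fail, uniformly at random. -/
noncomputable def cortesCost {n : ℕ} (k : ℕ) (x : Fin n → ℝ) : ℝ :=
  (n.choose k : ℝ)⁻¹ *
    ∑ A ∈ Finset.univ.filter (fun A : Finset (Fin n) => A.card = n - k), cost0 x A

/-- Expectation over the random uniform i.i.d. placement `x^rand ∈ [0,1]^n`
of the expected cost `C(x^rand)`. -/
noncomputable def randExp (n : ℕ) (p : ℝ) : ℝ :=
  ∫ x in Set.univ.pi (fun _ : Fin n => Set.Icc (0:ℝ) 1), expCost p x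

/-- `E[C_0(x^{rand,m})]`: expected coverage cost of `m` i.i.d. uniform sensors,
all active. -/
noncomputable def randCost0 (m : ℕ) : ℝ :=
  ∫ x in Set.univ.pi (fun _ : Fin m => Set.Icc (0:ℝ) 1), cost0 x Finset.univ

/-- `E[C^{k,n}(x^rand)]`: expectation over the random placement of the Cortés
model cost. -/
noncomputable def randCortes (n k : ℕ) : ℝ :=
  ∫ x in Set.univ.pi (fun _ : Fin n => Set.Icc (0:ℝ) 1), cortesCost k x

theorem prob_nonneg {n : ℕ} {p : ℝ} (hp : p ∈ Set.Ioo (0:ℝ) 1) (A : Finset (Fin n)) :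
    0 ≤ prob p A :=
  mul_nonneg (pow_nonneg hp.1.le _) (pow_nonneg (sub_nonneg.2 hp.2.le) _)

/-- The probability that all sensors of `S` fail is `p ^ #S`. -/
theorem sum_prob_subset_compl {n : ℕ} (p : ℝ) (S : Finset (Fin n)) :
    ∑ A ∈ Sᶜ.powerset, prob p A = p ^ #S := by
  have h := Finset.sum_pow_mul_eq_add_pow (1 - p) p Sᶜ
  rw [sub_add_cancel, one_pow] at h
  rw [← mul_one (p ^ #S), ← h, Finset.mul_sum]
  refine Finset.sum_congr rfl fun A hA => ?_
  have hA' := Finset.card_le_card (Finset.mem_powerset.1 hA)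
  have hS : #S + #Sᶜ = n := by simp
  have hn : n - #A = #S + (#Sᶜ - #A) := by omega
  rw [prob, hn, pow_add]
  ring

theorem sum_prob {n : ℕ} (p : ℝ) : ∑ A : Finset (Fin n), prob p A = 1 := by
  simpa using sum_prob_subset_compl p (∅ : Finset (Fin n))

/-- If `S k` is a family of index sets, the expected number of `k` such that all sensors of `S k`
fail is `∑ k, p ^ #(S k)`. -/
theorem sum_prob_mul_card_disjoint {n : ℕ} (p : ℝ) (S : Fin n → Finset (Fin n)) :
    ∑ A : Finset (Fin n), prob p A * (#{k | Disjoint A (S k)} : ℝ) = ∑ k, p ^ #(S k) := by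
  simp_rw [← sum_prob_subset_compl, Finset.card_filter, Nat.cast_sum, Finset.mul_sum]
  rw [Finset.sum_comm]
  refine Finset.sum_congr rfl fun k _ => ?_
  have h : (S k)ᶜ.powerset = Finset.univ.filter fun A => Disjoint A (S k) := by
    ext A
    rw [Finset.mem_powerset, Finset.subset_compl_iff_disjoint_right]
    simp
  rw [h, Finset.sum_filter]
  simp

/-- Length of the initial run of failed sensors. -/
def leadingRun {n : ℕ} (A : Finset (Fin n)) : ℕ := #{k | Disjoint A (Finset.Iic k)}

/-- Length of the final run of failed sensors. -/
def trailingRun {n : ℕ} (A : Finset (Fin n)) : ℕ := #{k | Disjoint A (Finset.Ici k)}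

theorem sum_range_pow_succ_le {p : ℝ} (hp : p ∈ Set.Ioo (0:ℝ) 1) (n : ℕ) :
    ∑ k ∈ Finset.range n, p ^ (k + 1) ≤ p / (1 - p) := by
  have h1 : 0 < 1 - p := sub_pos.2 hp.2
  rw [le_div_iff₀ h1]
  simp_rw [pow_succ, ← Finset.sum_mul]
  have h := geom_sum_mul_neg p n
  have h2 : 0 < p ^ n := pow_pos hp.1 n
  nlinarith [hp.1]

theorem sum_prob_mul_leadingRun_le {n : ℕ} {p : ℝ} (hp : p ∈ Set.Ioo (0:ℝ) 1) :
    ∑ A : Finset (Fin n), prob p A * (leadingRun A : ℝ) ≤ p / (1 - p) := by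
  simp_rw [leadingRun, sum_prob_mul_card_disjoint, Fin.card_Iic]
  rw [Fin.sum_univ_eq_sum_range (fun k => p ^ (k + 1))]
  exact sum_range_pow_succ_le hp n

theorem sum_prob_mul_trailingRun_le {n : ℕ} {p : ℝ} (hp : p ∈ Set.Ioo (0:ℝ) 1) :
    ∑ A : Finset (Fin n), prob p A * (trailingRun A : ℝ) ≤ p / (1 - p) := by
  simp_rw [trailingRun, sum_prob_mul_card_disjoint, Fin.card_Ici]
  rw [Fin.sum_univ_eq_sum_range (fun k => p ^ (n - k)), ← Finset.sum_range_reflect]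
  refine le_of_eq_of_le (Finset.sum_congr rfl fun k hk => ?_) (sum_range_pow_succ_le hp n)
  have := Finset.mem_range.1 hk
  congr 1
  omega

theorem le_leadingRun {n : ℕ} {A : Finset (Fin n)} {m : Fin n} (hm : ∀ j ∈ A, m ≤ j) :
    (m : ℕ) ≤ leadingRun A := by
  rw [← Fin.card_Iio m, leadingRun]
  refine Finset.card_le_card fun k hk => ?_
  simp only [Finset.mem_filter, Finset.mem_univ, true_and, Finset.disjoint_left, Finset.mem_Iic]
  exact fun j hj hjk => absurd (hm j hj) (not_le.2 (hjk.trans_lt (Finset.mem_Iio.1 hk)))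

theorem le_trailingRun {n : ℕ} {A : Finset (Fin n)} {m : Fin n} (hm : ∀ j ∈ A, j ≤ m) :
    n - 1 - (m : ℕ) ≤ trailingRun A := by
  rw [← Fin.card_Ioi m, trailingRun]
  refine Finset.card_le_card fun k hk => ?_
  simp only [Finset.mem_filter, Finset.mem_univ, true_and, Finset.disjoint_left, Finset.mem_Ici]
  exact fun j hj hjk => absurd (hm j hj) (not_le.2 ((Finset.mem_Ioi.1 hk).trans_le hjk))

theorem le_longestRun {n : ℕ} {A : Finset (Fin n)} {a r : ℕ} (har : a + r ≤ n)
    (h : ∀ i : Fin n, a ≤ i.1 → i.1 < a + r → i ∉ A) : r ≤ longestRun A :=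
  le_csSup ⟨n, fun _ ⟨_, hb, _⟩ => (Nat.le_add_left _ _).trans hb⟩ ⟨a, har, h⟩

theorem exists_longestRun {n : ℕ} (A : Finset (Fin n)) :
    ∃ a : ℕ, a + longestRun A ≤ n ∧
      ∀ i : Fin n, a ≤ i.1 → i.1 < a + longestRun A → i ∉ A :=
  Nat.sSup_mem
    (s := {r : ℕ | ∃ a : ℕ, a + r ≤ n ∧ ∀ i : Fin n, a ≤ i.1 → i.1 < a + r → i ∉ A})
    ⟨0, 0, by omega, fun i _ h => by omega⟩
    ⟨n, fun _ ⟨_, hb, _⟩ => (Nat.le_add_left _ _).trans hb⟩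

theorem le_cost0 {n : ℕ} (x : Fin n → ℝ) {A : Finset (Fin n)} (hA : A.Nonempty) {s d : ℝ}
    (hs : s ∈ Set.Icc (0:ℝ) 1) (h : ∀ j ∈ A, d ≤ |s - x j|) : d ≤ cost0 x A := by
  rw [cost0, if_pos hA]
  obtain ⟨j₀, hj₀⟩ := hA
  have : Nonempty A := ⟨⟨j₀, hj₀⟩⟩
  refine le_ciSup_of_le ⟨1 + |x j₀|, ?_⟩ ⟨s, hs⟩ (le_ciInf fun j => h j.1 j.2)
  rintro _ ⟨t, rfl⟩
  refine (ciInf_le (Set.finite_range _).bddBelow ⟨j₀, hj₀⟩).trans ?_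
  refine (abs_sub _ _).trans (add_le_add_left ?_ _)
  exact abs_le.2 ⟨by linarith [t.2.1], t.2.2⟩

theorem cost0_le {n : ℕ} (x : Fin n → ℝ) {A : Finset (Fin n)} (hA : A.Nonempty) {d : ℝ}
    (h : ∀ s ∈ Set.Icc (0:ℝ) 1, ∃ j ∈ A, |s - x j| ≤ d) : cost0 x A ≤ d := by
  rw [cost0, if_pos hA]
  have : Nonempty (Set.Icc (0:ℝ) 1) := ⟨⟨0, by simp⟩⟩
  refine ciSup_le fun s => ?_
  obtain ⟨j, hj, hd⟩ := h s.1 s.2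
  exact (ciInf_le (Set.finite_range _).bddBelow (⟨j, hj⟩ : A)).trans hd

theorem longestRun_add_one_div_le_cost0_xeq {n : ℕ} (hn : 1 ≤ n) (A : Finset (Fin n)) :
    ((longestRun A : ℝ) + 1) / (2 * n) ≤ cost0 (xeq n) A := by
  have hn' : (1:ℝ) ≤ n := by exact_mod_cast hn
  have h2n : (0:ℝ) < 2 * n := by linarith
  obtain ⟨a, ha, hrun⟩ := exists_longestRun A
  have haR : (a:ℝ) + longestRun A ≤ n := by exact_mod_cast ha
  have ha0 : (0:ℝ) ≤ a := a.cast_nonneg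
  have hR0 : (0:ℝ) ≤ longestRun A := (longestRun A).cast_nonneg
  rcases A.eq_empty_or_nonempty with hA | hA
  · rw [cost0, if_neg (by simp [hA]), div_le_one h2n]
    linarith
  refine le_cost0 _ hA (s := (2 * a + longestRun A) / (2 * n))
    ⟨by positivity, (div_le_one h2n).2 (by linarith)⟩ fun j hj => ?_
  rw [xeq, ← sub_div, abs_div, abs_of_pos h2n]
  refine div_le_div_of_nonneg_right ?_ h2n.le
  rcases lt_or_ge j.1 a with hja | hja
  · have : (j.1:ℝ) + 1 ≤ a := by exact_mod_cast hja
    exact le_abs.2 (Or.inl (by linarith))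
  · have h : a + longestRun A ≤ j.1 := not_lt.1 fun h => hrun j hja h hj
    have : (a:ℝ) + longestRun A ≤ j.1 := by exact_mod_cast h
    exact le_abs.2 (Or.inr (by linarith))

theorem cost0_xeq_le {n : ℕ} (hn : 1 ≤ n) (A : Finset (Fin n)) :
    cost0 (xeq n) A ≤
      ((longestRun A : ℝ) + 1 + leadingRun A + trailingRun A) / (2 * n) := by
  have hn' : (1:ℝ) ≤ n := by exact_mod_cast hn
  have h2n : (0:ℝ) < 2 * n := by linarith
  have hR0 : (0:ℝ) ≤ longestRun A := (longestRun A).cast_nonneg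
  have hL0 : (0:ℝ) ≤ leadingRun A := (leadingRun A).cast_nonneg
  have hT0 : (0:ℝ) ≤ trailingRun A := (trailingRun A).cast_nonneg
  rcases A.eq_empty_or_nonempty with hA | hA
  · have hL : leadingRun A = n := by simp [leadingRun, hA]
    have hT : trailingRun A = n := by simp [trailingRun, hA]
    rw [cost0, if_neg (by simp [hA]), le_div_iff₀ h2n, hL, hT]
    linarith
  refine cost0_le _ hA fun s hs => ?_
  have hscale : ∀ j : Fin n, |s - xeq n j| = |2 * n * s - (2 * j + 1)| / (2 * n) := fun j => by
    rw [xeq, ← abs_of_pos h2n, ← abs_div, abs_of_pos h2n]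
    congr 1
    field_simp
  simp only [hscale, div_le_div_iff_of_pos_right h2n]
  have ht0 : 0 ≤ 2 * n * s := mul_nonneg h2n.le hs.1
  have ht1 : 2 * n * s ≤ 2 * n := mul_le_of_le_one_right h2n.le hs.2
  generalize 2 * n * s = t at ht0 ht1
  set B := A.filter fun j : Fin n => 2 * (j:ℝ) + 1 ≤ t
  set D := A.filter fun j : Fin n => t < 2 * (j:ℝ) + 1
  rcases B.eq_empty_or_nonempty with hB0 | hB0
  · refine ⟨A.min' hA, A.min'_mem hA, ?_⟩
    have hmin : ∀ j ∈ A, A.min' hA ≤ j := fun j hj => A.min'_le j hj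
    have hlt : t < 2 * (A.min' hA : ℝ) + 1 := not_le.1 fun h =>
      (Finset.filter_eq_empty_iff.1 hB0) (A.min'_mem hA) h
    have hL : ((A.min' hA : ℕ) : ℝ) ≤ leadingRun A := by exact_mod_cast le_leadingRun hmin
    have hR : ((A.min' hA : ℕ) : ℝ) ≤ longestRun A := by
      refine Nat.cast_le.2 (le_longestRun (a := 0) (by omega) fun i _ hi hiA => ?_)
      have := Fin.le_def.1 (hmin i hiA)
      omega
    exact abs_le.2 ⟨by linarith, by linarith⟩
  rcases D.eq_empty_or_nonempty with hD0 | hD0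
  · refine ⟨A.max' hA, A.max'_mem hA, ?_⟩
    have hmax : ∀ j ∈ A, j ≤ A.max' hA := fun j hj => A.le_max' j hj
    have hle : 2 * (A.max' hA : ℝ) + 1 ≤ t := not_lt.1 fun h =>
      (Finset.filter_eq_empty_iff.1 hD0) (A.max'_mem hA) h
    have hlt := (A.max' hA).isLt
    have hT : (n:ℝ) ≤ trailingRun A + 1 + (A.max' hA : ℕ) := by
      have := le_trailingRun hmax
      exact_mod_cast (by omega : n ≤ trailingRun A + 1 + (A.max' hA : ℕ))
    have hR : (n:ℝ) ≤ longestRun A + 1 + (A.max' hA : ℕ) := by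
      have : n - 1 - (A.max' hA : ℕ) ≤ longestRun A := by
        refine le_longestRun (a := (A.max' hA : ℕ) + 1) (by omega) fun i hi _ hiA => ?_
        have := Fin.le_def.1 (hmax i hiA)
        omega
      exact_mod_cast (by omega : n ≤ longestRun A + 1 + (A.max' hA : ℕ))
    exact abs_le.2 ⟨by linarith, by linarith⟩
  obtain ⟨hbA, hbt⟩ := Finset.mem_filter.1 (B.max'_mem hB0)
  obtain ⟨hdA, hdt⟩ := Finset.mem_filter.1 (D.min'_mem hD0)
  set b := B.max' hB0
  set d := D.min' hD0
  have hbd : b.1 < d.1 := by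
    have : (b.1:ℝ) < d.1 := by linarith
    exact_mod_cast this
  have hR : (d.1:ℝ) ≤ longestRun A + 1 + b.1 := by
    have : d.1 - 1 - b.1 ≤ longestRun A := by
      refine le_longestRun (a := b.1 + 1) (by omega) fun i hi hi' hiA => ?_
      rcases le_or_gt (2 * (i:ℝ) + 1) t with h | h
      · have := Fin.le_def.1 (B.le_max' i (Finset.mem_filter.2 ⟨hiA, h⟩))
        omega
      · have := Fin.le_def.1 (D.min'_le i (Finset.mem_filter.2 ⟨hiA, h⟩))
        omega
    exact_mod_cast (by omega : d.1 ≤ longestRun A + 1 + b.1)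
  rcases le_or_gt (t - (2 * (b:ℝ) + 1)) (longestRun A + 1) with h | h
  · exact ⟨b, hbA, abs_le.2 ⟨by linarith, by linarith⟩⟩
  · exact ⟨d, hdA, abs_le.2 ⟨by linarith, by linarith⟩⟩

/-- with `E[R_n] = ∑_A Pr(E_A) R(A)` the expected longest run of
failures, `(E[R_n]+1)/(2n) ≤ C(x^eq) ≤ (E[R_n]+1)/(2n) + (2p/(1-p)+1)/n`. -/
theorem expCost_xeq_run_bounds {n : ℕ} (hn : 1 ≤ n) (p : ℝ)
    (hp : p ∈ Set.Ioo (0:ℝ) 1) :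
    ((∑ A : Finset (Fin n), prob p A * (longestRun A : ℝ)) + 1) / (2 * n)
        ≤ expCost p (xeq n) ∧
    expCost p (xeq n)
        ≤ ((∑ A : Finset (Fin n), prob p A * (longestRun A : ℝ)) + 1) / (2 * n)
          + (2 * p / (1 - p) + 1) / n := by
  have hn' : (0:ℝ) < n := by exact_mod_cast hn
  have hp1 : 0 < 1 - p := sub_pos.2 hp.2
  set E := ∑ A : Finset (Fin n), prob p A * (longestRun A : ℝ) with hE
  constructor
  · calc (E + 1) / (2 * n)
        = ∑ A : Finset (Fin n), prob p A * (((longestRun A : ℝ) + 1) / (2 * n)) := by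
          simp_rw [← mul_div_assoc, ← Finset.sum_div, mul_add, mul_one, Finset.sum_add_distrib,
            sum_prob, hE]
      _ ≤ expCost p (xeq n) := Finset.sum_le_sum fun A _ =>
          mul_le_mul_of_nonneg_left (longestRun_add_one_div_le_cost0_xeq hn A) (prob_nonneg hp A)
  · calc expCost p (xeq n)
        ≤ ∑ A : Finset (Fin n), prob p A *
            (((longestRun A : ℝ) + 1 + leadingRun A + trailingRun A) / (2 * n)) :=
          Finset.sum_le_sum fun A _ =>
            mul_le_mul_of_nonneg_left (cost0_xeq_le hn A) (prob_nonneg hp A)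
      _ = (E + 1 + ∑ A : Finset (Fin n), prob p A * (leadingRun A : ℝ)
            + ∑ A : Finset (Fin n), prob p A * (trailingRun A : ℝ)) / (2 * n) := by
          simp_rw [← mul_div_assoc, ← Finset.sum_div, mul_add, mul_one, Finset.sum_add_distrib,
            sum_prob, hE]
      _ ≤ (E + 1 + p / (1 - p) + p / (1 - p)) / (2 * n) := by
          gcongr
          · exact sum_prob_mul_leadingRun_le hp
          · exact sum_prob_mul_trailingRun_le hp
      _ = (E + 1) / (2 * n) + (p / (1 - p)) / n := by
          field_simp
          ring
      _ ≤ (E + 1) / (2 * n) + (2 * p / (1 - p) + 1) / n := by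
          have h : 0 ≤ p / (1 - p) := div_nonneg hp.1.le hp1.le
          gcongr
          rw [mul_div_assoc]
          linarith
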